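/- Let n ≥ 2, let Ω^o be a bounded open subset of ℝ^n with 0 ∈ Ω^o, let S = ∂Ω^o be its topological boundary, and assume σ_S is a finite measure. Let θ : ℝ^n → ℝ be continuous, let t ∈ ℝ^n, and let k ∈ ℕ. Then the map ε ↦ ∫ G_n(ε·t − y)·θ(y) dσ_S(y) is smooth on the interval {ε : |ε|·‖t‖ < dist(0, S)} and its k-th derivative at ε = 0 equals (−1)^k · Σ_{β ∈ ℕ^n, |β| = k} (k!/β!)·t^β · ∫ (D^β G_n)(y)·θ(y) dσ_S(y). -/

import Mathlib

open MeasureTheory RealInnerProductSpace Pointwise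

/-- The measure `σ_S`: the `(n-1)`-dimensional Hausdorff measure on `ℝⁿ` restricted to `S`. -/
noncomputable def bdryMeasure (n : ℕ) (S : Set (EuclideanSpace ℝ (Fin n))) :
    Measure (EuclideanSpace ℝ (Fin n)) := (μH[(n : ℝ) - 1]).restrict S

/-- `s_n`: the `(n-1)`-dimensional Hausdorff measure of the unit sphere of `ℝⁿ`. -/
noncomputable def sphereArea (n : ℕ) : ℝ :=
  (μH[(n : ℝ) - 1] (Metric.sphere (0 : EuclideanSpace ℝ (Fin n)) 1)).toReal

/-- The fundamental solution `G_n` of `-Δ` in `ℝⁿ`. -/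
noncomputable def fundSol (n : ℕ) (x : EuclideanSpace ℝ (Fin n)) : ℝ :=
  if n = 2 then -(1 / (2 * Real.pi)) * Real.log ‖x‖
  else (1 / (((n : ℝ) - 2) * sphereArea n)) * ‖x‖ ^ ((2 : ℝ) - (n : ℝ))

/-- The partial derivative in the `i`-th coordinate direction. -/
noncomputable def pderiv' {n : ℕ} (i : Fin n) (F : EuclideanSpace ℝ (Fin n) → ℝ) :
    EuclideanSpace ℝ (Fin n) → ℝ :=
  fun x => lineDeriv ℝ F x (EuclideanSpace.single i 1)

/-- The iterated partial derivative `D^β F` of multi-index `β`. -/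
noncomputable def multiDeriv {n : ℕ} (β : Fin n → ℕ) (F : EuclideanSpace ℝ (Fin n) → ℝ) :
    EuclideanSpace ℝ (Fin n) → ℝ :=
  (List.finRange n).foldr (fun i G => (pderiv' i)^[β i] G) F

section aux6

variable {n : ℕ}

/-- Functions smooth away from `0`, normalized to vanish at `0`. -/
def smoothOff (n : ℕ) : Submodule ℝ (EuclideanSpace ℝ (Fin n) → ℝ) where
  carrier := {f | ContDiffOn ℝ (⊤ : ℕ∞) f {0}ᶜ ∧ f 0 = 0}
  add_mem' := by
    rintro f g ⟨hf, hf0⟩ ⟨hg, hg0⟩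
    exact ⟨hf.add hg, by simp [hf0, hg0]⟩
  zero_mem' := ⟨contDiffOn_const, rfl⟩
  smul_mem' := by
    rintro c f ⟨hf, hf0⟩
    exact ⟨contDiffOn_const.smul hf, by simp [hf0]⟩

theorem smoothOff.cda (f : smoothOff n) {x : EuclideanSpace ℝ (Fin n)} (hx : x ≠ 0) :
    ContDiffAt ℝ (⊤ : ℕ∞) (f : EuclideanSpace ℝ (Fin n) → ℝ) x :=
  f.2.1.contDiffAt (isOpen_compl_singleton.mem_nhds hx)

theorem smoothOff.da (f : smoothOff n) {x : EuclideanSpace ℝ (Fin n)} (hx : x ≠ 0) :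
    DifferentiableAt ℝ (f : EuclideanSpace ℝ (Fin n) → ℝ) x :=
  (smoothOff.cda f hx).differentiableAt (by simp)

open Classical in
/-- Directional derivative away from zero. -/
noncomputable def dirD (v : EuclideanSpace ℝ (Fin n)) : Module.End ℝ (smoothOff n) where
  toFun f := ⟨fun x => if x = 0 then 0 else fderiv ℝ (f : EuclideanSpace ℝ (Fin n) → ℝ) x v, by
    refine ⟨?_, by simp⟩
    have h : ContDiffOn ℝ (⊤ : ℕ∞)
        (fun x => fderiv ℝ (f : EuclideanSpace ℝ (Fin n) → ℝ) x v) {0}ᶜ :=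
      (f.2.1.fderiv_of_isOpen isOpen_compl_singleton (by simp)).clm_apply contDiffOn_const
    refine h.congr fun x hx => ?_
    have hx' : x ≠ 0 := hx
    simp [hx']⟩
  map_add' f g := by
    ext x
    by_cases hx : x = 0
    · simp [hx]
    · simp [hx, fderiv_add (smoothOff.da f hx) (smoothOff.da g hx)]
  map_smul' c f := by
    ext x
    by_cases hx : x = 0
    · simp [hx]
    · simp [hx, fderiv_const_smul (smoothOff.da f hx)]

theorem dirD_apply (v : EuclideanSpace ℝ (Fin n)) (f : smoothOff n)
    {x : EuclideanSpace ℝ (Fin n)} (hx : x ≠ 0) :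
    (dirD v f : EuclideanSpace ℝ (Fin n) → ℝ) x = fderiv ℝ (f : EuclideanSpace ℝ (Fin n) → ℝ) x v := by
  simp [dirD, hx]

theorem dirD_zero (v : EuclideanSpace ℝ (Fin n)) (f : smoothOff n) :
    (dirD v f : EuclideanSpace ℝ (Fin n) → ℝ) 0 = 0 := (dirD v f).2.2

theorem dirD_dirD (v w : EuclideanSpace ℝ (Fin n)) (f : smoothOff n)
    {x : EuclideanSpace ℝ (Fin n)} (hx : x ≠ 0) :
    (dirD v (dirD w f) : EuclideanSpace ℝ (Fin n) → ℝ) x =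
      fderiv ℝ (fderiv ℝ (f : EuclideanSpace ℝ (Fin n) → ℝ)) x v w := by
  rw [dirD_apply v _ hx]
  have h1 : (dirD w f : EuclideanSpace ℝ (Fin n) → ℝ) =ᶠ[nhds x]
      fun y => fderiv ℝ (f : EuclideanSpace ℝ (Fin n) → ℝ) y w := by
    filter_upwards [isOpen_compl_singleton.mem_nhds hx] with y hy
    exact dirD_apply w f hy
  rw [h1.fderiv_eq]
  have h2 : DifferentiableAt ℝ (fderiv ℝ (f : EuclideanSpace ℝ (Fin n) → ℝ)) x :=
    ((smoothOff.cda f hx).fderiv_right (m := 1) (by norm_cast)).differentiableAt (by simp)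
  rw [fderiv_clm_apply h2 (differentiableAt_const _)]
  simp

theorem dirD_comm (v w : EuclideanSpace ℝ (Fin n)) :
    Commute (dirD v : Module.End ℝ (smoothOff n)) (dirD w) := by
  ext f x
  by_cases hx : x = 0
  · subst hx
    exact (dirD_zero _ _).trans (dirD_zero _ _).symm
  · have := (smoothOff.cda f hx).isSymmSndFDerivAt (by simp; norm_cast)
    exact (dirD_dirD v w f hx).trans ((this v w).trans (dirD_dirD w v f hx).symm)

theorem dirD_eq (t : EuclideanSpace ℝ (Fin n)) :
    (dirD (-t) : Module.End ℝ (smoothOff n)) =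
      (-1 : ℝ) • ∑ i, (t i) • (dirD (EuclideanSpace.single i 1) : Module.End ℝ (smoothOff n)) := by
  ext f x
  by_cases hx : x = 0
  · subst hx
    rw [dirD_zero]
    exact (Subtype.prop _ : _ ∈ smoothOff n).2.symm
  · rw [dirD_apply _ _ hx]
    have ht : t = ∑ i, t i • EuclideanSpace.single i (1:ℝ) := by
      ext j
      simp [Finset.sum_apply, Pi.single_apply]
    conv_lhs => rw [ht]
    simp [dirD_apply _ _ hx, LinearMap.sum_apply]

theorem prod_smul_list {ι R M : Type*} [CommSemiring R] [Semiring M] [Algebra R M]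
    (l : List ι) (c : ι → R) (m : ι → M) :
    (l.map (fun i => c i • m i)).prod = (l.map c).prod • (l.map m).prod := by
  induction l with
  | nil => simp
  | cons a l ih => simp only [List.map_cons, List.prod_cons, ih, smul_mul_smul_comm]

theorem pow_dirD (t : EuclideanSpace ℝ (Fin n)) (k : ℕ) :
    (dirD (-t) : Module.End ℝ (smoothOff n)) ^ k =
      (-1 : ℝ) ^ k • ∑ β ∈ Finset.Nat.antidiagonalTuple n k,
        (((k.factorial : ℝ) / ∏ i, ((β i).factorial : ℝ)) * (∏ i, t i ^ β i)) •
        ((List.finRange n).map fun i =>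
          (dirD (EuclideanSpace.single i 1) : Module.End ℝ (smoothOff n)) ^ β i).prod := by
  rw [dirD_eq, smul_pow]
  have hc : ((Finset.univ : Finset (Fin n)) : Set (Fin n)).Pairwise
      (Function.onFun Commute fun i => (t i) •
        (dirD (EuclideanSpace.single i 1) : Module.End ℝ (smoothOff n))) := by
    intro i _ j _ _
    exact ((dirD_comm _ _).smul_left _).smul_right _
  rw [Finset.sum_pow_eq_sum_piAntidiag_of_commute _ _ hc,
    Finset.piAntidiag_univ_fin_eq_antidiagonalTuple]
  congr 1
  refine Finset.sum_congr rfl fun β hβ => ?_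
  have hs : ∑ i, β i = k := Finset.Nat.mem_antidiagonalTuple.1 hβ
  have h2 : (Finset.univ : Finset (Fin n)).noncommProd (fun i => ((t i) •
        (dirD (EuclideanSpace.single i 1) : Module.End ℝ (smoothOff n))) ^ β i)
        (hc.mono' fun _ _ h => h.pow_pow ..) =
      (∏ i, t i ^ β i) • ((List.finRange n).map fun i =>
          (dirD (EuclideanSpace.single i 1) : Module.End ℝ (smoothOff n)) ^ β i).prod := by
    have h3 : ∀ c, (Finset.univ : Finset (Fin n)).noncommProd (fun i => ((t i) •
        (dirD (EuclideanSpace.single i 1) : Module.End ℝ (smoothOff n))) ^ β i) c =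
        ((List.finRange n).map fun i => ((t i) •
        (dirD (EuclideanSpace.single i 1) : Module.End ℝ (smoothOff n))) ^ β i).prod := by
      have e : (Finset.univ : Finset (Fin n)) = (List.finRange n).toFinset := by ext; simp
      rw [e]
      intro c
      exact Finset.noncommProd_toFinset _ _ _ (List.nodup_finRange n)
    rw [h3]
    simp only [smul_pow]
    rw [prod_smul_list]
    congr 1
  rw [h2]
  have h4 : ((Nat.multinomial Finset.univ β : ℕ) : ℝ) =
      (k.factorial : ℝ) / ∏ i, ((β i).factorial : ℝ) := by
    have hpos : (∏ i, ((β i).factorial : ℝ)) ≠ 0 :=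
      Finset.prod_ne_zero_iff.2 fun i _ => by positivity
    rw [eq_div_iff hpos]
    have := Nat.multinomial_spec Finset.univ β
    rw [hs] at this
    rw [← this]
    push_cast
    ring
  rw [← h4, mul_smul, ← nsmul_eq_mul, Nat.cast_smul_eq_nsmul]

theorem pderiv'_congr (i : Fin n) (F : EuclideanSpace ℝ (Fin n) → ℝ) (f : smoothOff n)
    (h : ∀ x ≠ 0, F x = (f : EuclideanSpace ℝ (Fin n) → ℝ) x) :
    ∀ x ≠ 0, pderiv' i F x =
      (dirD (EuclideanSpace.single i 1) f : EuclideanSpace ℝ (Fin n) → ℝ) x := by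
  intro x hx
  have h1 : F =ᶠ[nhds x] (f : EuclideanSpace ℝ (Fin n) → ℝ) := by
    filter_upwards [isOpen_compl_singleton.mem_nhds hx] with y hy
    exact h y hy
  rw [dirD_apply _ _ hx, pderiv', h1.lineDeriv_eq, (smoothOff.da f hx).lineDeriv_eq_fderiv]

theorem pderiv'_iter (i : Fin n) (m : ℕ) (F : EuclideanSpace ℝ (Fin n) → ℝ) (f : smoothOff n)
    (h : ∀ x ≠ 0, F x = (f : EuclideanSpace ℝ (Fin n) → ℝ) x) :
    ∀ x ≠ 0, (pderiv' i)^[m] F x =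
      (((dirD (EuclideanSpace.single i 1) : Module.End ℝ (smoothOff n)) ^ m) f :
        EuclideanSpace ℝ (Fin n) → ℝ) x := by
  induction m with
  | zero => simpa using h
  | succ m ih =>
    rw [Function.iterate_succ_apply', pow_succ']
    exact pderiv'_congr i _ _ ih

theorem multiDeriv_eq (β : Fin n → ℕ) (F : EuclideanSpace ℝ (Fin n) → ℝ) (f : smoothOff n)
    (h : ∀ x ≠ 0, F x = (f : EuclideanSpace ℝ (Fin n) → ℝ) x) :
    ∀ x ≠ 0, multiDeriv β F x = ((((List.finRange n).map fun i =>
          (dirD (EuclideanSpace.single i 1) : Module.End ℝ (smoothOff n)) ^ β i).prod) f :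
        EuclideanSpace ℝ (Fin n) → ℝ) x := by
  unfold multiDeriv
  induction List.finRange n with
  | nil => simpa using h
  | cons a l ih =>
    rw [List.map_cons, List.prod_cons]
    exact pderiv'_iter a _ _ _ ih

theorem fundSol_contDiffOn (n : ℕ) : ContDiffOn ℝ (⊤ : ℕ∞) (fundSol n) {0}ᶜ := by
  intro x hx
  have hx' : x ≠ 0 := hx
  apply ContDiffAt.contDiffWithinAt
  have hN : ContDiffAt ℝ (⊤ : ℕ∞) (fun y : EuclideanSpace ℝ (Fin n) => ‖y‖) x :=
    contDiffAt_norm ℝ hx'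
  unfold fundSol
  split_ifs
  · exact contDiffAt_const.mul (hN.log (norm_ne_zero_iff.2 hx'))
  · exact contDiffAt_const.mul (hN.rpow_const_of_ne (norm_ne_zero_iff.2 hx'))

open Classical in
/-- The fundamental solution as an element of `smoothOff`. -/
noncomputable def fundS (n : ℕ) : smoothOff n :=
  ⟨fun x => if x = 0 then 0 else fundSol n x, (fundSol_contDiffOn n).congr fun x hx => by
    have hx' : x ≠ 0 := hx
    simp [hx'], by simp⟩

theorem fundS_apply (n : ℕ) : ∀ x ≠ 0, fundSol n x =
    (fundS n : EuclideanSpace ℝ (Fin n) → ℝ) x := by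
  intro x hx
  simp [fundS, hx]

theorem fundSol_neg (x y : EuclideanSpace ℝ (Fin n)) : fundSol n (x - y) = fundSol n (y - x) := by
  simp only [fundSol, norm_sub_rev x y]

variable {S : Set (EuclideanSpace ℝ (Fin n))} {t : EuclideanSpace ℝ (Fin n)}

theorem sub_ne {ε : ℝ} (hε : |ε| * ‖t‖ < Metric.infDist 0 S)
    {y : EuclideanSpace ℝ (Fin n)} (hy : y ∈ S) : y - ε • t ≠ 0 := by
  intro h
  have h1 := Metric.infDist_le_dist_of_mem (x := (0 : EuclideanSpace ℝ (Fin n))) hy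
  rw [sub_eq_zero.1 h, dist_zero_left, norm_smul, Real.norm_eq_abs] at h1
  linarith

theorem isOpen_dom : IsOpen {ε : ℝ | |ε| * ‖t‖ < Metric.infDist 0 S} :=
  isOpen_lt (by fun_prop) continuous_const

theorem contOn_aux (f : smoothOff n) (θ : EuclideanSpace ℝ (Fin n) → ℝ) (hθ : Continuous θ)
    {ε : ℝ} (hε : |ε| * ‖t‖ < Metric.infDist 0 S) :
    ContinuousOn (fun y => (f : EuclideanSpace ℝ (Fin n) → ℝ) (y - ε • t) * θ y) S := by
  refine ContinuousOn.mul ?_ hθ.continuousOn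
  exact f.2.1.continuousOn.comp (by fun_prop) fun y hy => sub_ne hε hy

theorem meas_aux (hS : IsCompact S) (f : smoothOff n) (θ : EuclideanSpace ℝ (Fin n) → ℝ)
    (hθ : Continuous θ) {ε : ℝ} (hε : |ε| * ‖t‖ < Metric.infDist 0 S) :
    AEStronglyMeasurable (fun y => (f : EuclideanSpace ℝ (Fin n) → ℝ) (y - ε • t) * θ y)
      (bdryMeasure n S) :=
  (contOn_aux f θ hθ hε).aestronglyMeasurable hS.measurableSet

theorem ae_mem_aux (hS : IsCompact S) : ∀ᵐ y ∂(bdryMeasure n S), y ∈ S :=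
  ae_restrict_mem hS.measurableSet

theorem int_aux (hS : IsCompact S) [IsFiniteMeasure (bdryMeasure n S)]
    (f : smoothOff n) (θ : EuclideanSpace ℝ (Fin n) → ℝ)
    (hθ : Continuous θ) {ε : ℝ} (hε : |ε| * ‖t‖ < Metric.infDist 0 S) :
    Integrable (fun y => (f : EuclideanSpace ℝ (Fin n) → ℝ) (y - ε • t) * θ y)
      (bdryMeasure n S) := by
  obtain ⟨C, hC⟩ := hS.exists_bound_of_continuousOn (contOn_aux f θ hθ hε)
  exact Integrable.of_bound (meas_aux hS f θ hθ hε) C ((ae_mem_aux hS).mono hC)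

theorem hasDeriv_aux (hS : IsCompact S) [IsFiniteMeasure (bdryMeasure n S)]
    (f : smoothOff n) (θ : EuclideanSpace ℝ (Fin n) → ℝ)
    (hθ : Continuous θ) {ε : ℝ} (hε : |ε| * ‖t‖ < Metric.infDist 0 S) :
    HasDerivAt (fun ε : ℝ => ∫ y, (f : EuclideanSpace ℝ (Fin n) → ℝ) (y - ε • t) * θ y
        ∂(bdryMeasure n S))
      (∫ y, (dirD (-t) f : EuclideanSpace ℝ (Fin n) → ℝ) (y - ε • t) * θ y
        ∂(bdryMeasure n S)) ε := by
  obtain ⟨r, hr, hrD⟩ := Metric.nhds_basis_closedBall.mem_iff.1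
    ((isOpen_dom (S := S) (t := t)).mem_nhds hε)
  have hcont : ContinuousOn (fun p : ℝ × EuclideanSpace ℝ (Fin n) =>
      (dirD (-t) f : EuclideanSpace ℝ (Fin n) → ℝ) (p.2 - p.1 • t) * θ p.2)
      (Metric.closedBall ε r ×ˢ S) := by
    refine ContinuousOn.mul ?_ (by fun_prop)
    exact (dirD (-t) f).2.1.continuousOn.comp (by fun_prop)
      fun p hp => sub_ne (hrD hp.1) hp.2
  obtain ⟨C, hC⟩ := ((isCompact_closedBall ε r).prod hS).exists_bound_of_continuousOn hcont
  refine (hasDerivAt_integral_of_dominated_loc_of_deriv_le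
    (F := fun ε y => (f : EuclideanSpace ℝ (Fin n) → ℝ) (y - ε • t) * θ y)
    (F' := fun ε y => (dirD (-t) f : EuclideanSpace ℝ (Fin n) → ℝ) (y - ε • t) * θ y)
    (bound := fun _ => C) (Metric.closedBall_mem_nhds ε hr) ?_ (int_aux hS f θ hθ hε)
    (meas_aux hS _ θ hθ hε) ?_ (integrable_const C) ?_).2
  · filter_upwards [(isOpen_dom (S := S) (t := t)).mem_nhds hε] with x hx
    exact meas_aux hS f θ hθ hx
  · filter_upwards [ae_mem_aux hS] with y hy x hx
    exact hC (x, y) ⟨hx, hy⟩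
  · filter_upwards [ae_mem_aux hS] with y hy x hx
    have hne := sub_ne (hrD hx) hy
    refine HasDerivAt.mul_const ?_ _
    rw [dirD_apply _ _ hne]
    have h1 : HasDerivAt (fun x : ℝ => y - x • t) (-t) x := by
      simpa using ((hasDerivAt_id x).smul_const t).const_sub y
    exact (smoothOff.da f hne).hasFDerivAt.comp_hasDerivAt x h1

theorem iter_aux (hS : IsCompact S) [IsFiniteMeasure (bdryMeasure n S)]
    (f : smoothOff n) (θ : EuclideanSpace ℝ (Fin n) → ℝ)
    (hθ : Continuous θ) (Φ : ℝ → ℝ)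
    (hΦ : ∀ ε : ℝ, |ε| * ‖t‖ < Metric.infDist 0 S →
      Φ ε = ∫ y, (f : EuclideanSpace ℝ (Fin n) → ℝ) (y - ε • t) * θ y ∂(bdryMeasure n S))
    (k : ℕ) : ∀ ε : ℝ, |ε| * ‖t‖ < Metric.infDist 0 S →
      iteratedDeriv k Φ ε = ∫ y, (((dirD (-t) : Module.End ℝ (smoothOff n)) ^ k) f :
        EuclideanSpace ℝ (Fin n) → ℝ) (y - ε • t) * θ y ∂(bdryMeasure n S) := by
  induction k with
  | zero => simpa using hΦ
  | succ k ih =>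
    intro ε hε
    rw [iteratedDeriv_succ]
    have h1 : iteratedDeriv k Φ =ᶠ[nhds ε] fun ε => ∫ y,
        (((dirD (-t) : Module.End ℝ (smoothOff n)) ^ k) f :
        EuclideanSpace ℝ (Fin n) → ℝ) (y - ε • t) * θ y ∂(bdryMeasure n S) := by
      filter_upwards [(isOpen_dom (S := S) (t := t)).mem_nhds hε] with x hx
      exact ih x hx
    rw [h1.deriv_eq, (hasDeriv_aux hS _ θ hθ hε).deriv, pow_succ']
    rfl

theorem smooth_aux (hS : IsCompact S) [IsFiniteMeasure (bdryMeasure n S)]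
    (f : smoothOff n) (θ : EuclideanSpace ℝ (Fin n) → ℝ)
    (hθ : Continuous θ) (Φ : ℝ → ℝ)
    (hΦ : ∀ ε : ℝ, |ε| * ‖t‖ < Metric.infDist 0 S →
      Φ ε = ∫ y, (f : EuclideanSpace ℝ (Fin n) → ℝ) (y - ε • t) * θ y ∂(bdryMeasure n S)) :
    ContDiffOn ℝ (⊤ : ℕ∞) Φ {ε : ℝ | |ε| * ‖t‖ < Metric.infDist 0 S} := by
  refine contDiffOn_of_differentiableOn_deriv fun m _ => ?_
  have h1 : ∀ ε ∈ {ε : ℝ | |ε| * ‖t‖ < Metric.infDist 0 S},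
      iteratedDerivWithin m Φ {ε : ℝ | |ε| * ‖t‖ < Metric.infDist 0 S} ε = ∫ y,
        (((dirD (-t) : Module.End ℝ (smoothOff n)) ^ m) f :
        EuclideanSpace ℝ (Fin n) → ℝ) (y - ε • t) * θ y ∂(bdryMeasure n S) := by
    intro ε hε
    rw [iteratedDerivWithin_of_isOpen isOpen_dom hε]
    exact iter_aux hS f θ hθ Φ hΦ m ε hε
  refine DifferentiableOn.congr ?_ h1
  intro ε hε
  exact (hasDeriv_aux hS _ θ hθ hε).differentiableAt.differentiableWithinAt

end aux6

/-- The map `ε ↦ ∫_{∂Ωᵒ} G_n(ε•t - y) θ(y) dσ(y)` is smooth on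
`{ε : |ε| · ‖t‖ < dist(0, ∂Ωᵒ)}` and its `k`-th derivative at `ε = 0` is
`(-1)^k ∑_{|β|=k} (k!/β!) t^β ∫_{∂Ωᵒ} (D^β G_n)(y) θ(y) dσ(y)`. -/
theorem stmt6 (n : ℕ) (hn : 2 ≤ n) (Ωo : Set (EuclideanSpace ℝ (Fin n)))
    (hΩ : IsOpen Ωo) (hb : Bornology.IsBounded Ωo) (h0 : (0 : EuclideanSpace ℝ (Fin n)) ∈ Ωo)
    (hfin : IsFiniteMeasure (bdryMeasure n (frontier Ωo)))
    (θ : EuclideanSpace ℝ (Fin n) → ℝ) (hθ : Continuous θ)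
    (t : EuclideanSpace ℝ (Fin n)) (k : ℕ) :
    ContDiffOn ℝ (⊤ : ℕ∞) (fun ε : ℝ => ∫ y, fundSol n (ε • t - y) * θ y ∂(bdryMeasure n (frontier Ωo)))
        {ε : ℝ | |ε| * ‖t‖ < Metric.infDist (0 : EuclideanSpace ℝ (Fin n)) (frontier Ωo)} ∧
    iteratedDeriv k
        (fun ε : ℝ => ∫ y, fundSol n (ε • t - y) * θ y ∂(bdryMeasure n (frontier Ωo))) 0 =
      (-1 : ℝ) ^ k * ∑ β ∈ Finset.Nat.antidiagonalTuple n k,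
        ((k.factorial : ℝ) / ∏ i, ((β i).factorial : ℝ)) * (∏ i, t i ^ β i) *
          ∫ y, multiDeriv β (fundSol n) y * θ y ∂(bdryMeasure n (frontier Ωo)) := by
  set S := frontier Ωo with hSdef
  have hS : IsCompact S := Metric.isCompact_of_isClosed_isBounded isClosed_frontier
    (hb.closure.subset frontier_subset_closure)
  have : Nontrivial (EuclideanSpace ℝ (Fin n)) := by
    have : Nonempty (Fin n) := ⟨⟨0, by omega⟩⟩
    infer_instance
  have hne : S.Nonempty := by
    rw [hSdef, nonempty_frontier_iff]
    refine ⟨⟨0, h0⟩, ?_⟩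
    rintro rfl
    exact NormedSpace.unbounded_univ ℝ _ hb
  have h0S : (0 : EuclideanSpace ℝ (Fin n)) ∉ S := fun h => by
    rw [hSdef, hΩ.frontier_eq] at h
    exact h.2 h0
  have hpos : 0 < Metric.infDist (0 : EuclideanSpace ℝ (Fin n)) S :=
    (isClosed_frontier.notMem_iff_infDist_pos hne).1 h0S
  have hΦ : ∀ ε : ℝ, |ε| * ‖t‖ < Metric.infDist 0 S →
      (fun ε : ℝ => ∫ y, fundSol n (ε • t - y) * θ y ∂(bdryMeasure n S)) ε =
      ∫ y, (fundS n : EuclideanSpace ℝ (Fin n) → ℝ) (y - ε • t) * θ y ∂(bdryMeasure n S) := by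
    intro ε hε
    refine integral_congr_ae ?_
    filter_upwards [ae_mem_aux hS] with y hy
    rw [fundSol_neg, fundS_apply n _ (sub_ne hε hy)]
  refine ⟨smooth_aux hS (fundS n) θ hθ _ hΦ, ?_⟩
  have hd0 : |(0 : ℝ)| * ‖t‖ < Metric.infDist 0 S := by simpa using hpos
  rw [iter_aux hS (fundS n) θ hθ _ hΦ k 0 hd0, pow_dirD]
  simp only [zero_smul, sub_zero, LinearMap.smul_apply, LinearMap.sum_apply,
    Submodule.coe_smul, Submodule.coe_sum, Pi.smul_apply, Finset.sum_apply, smul_eq_mul]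
  simp only [mul_assoc ((-1 : ℝ) ^ k), integral_const_mul, Finset.sum_mul]
  rw [integral_finsetSum]
  · congr 1
    refine Finset.sum_congr rfl fun β _ => ?_
    rw [← integral_const_mul]
    refine integral_congr_ae ?_
    filter_upwards [ae_mem_aux hS] with y hy
    have hy0 : y ≠ 0 := fun h => h0S (h ▸ hy)
    rw [multiDeriv_eq β _ _ (fundS_apply n) y hy0]
    ring
  · intro β _
    simp only [mul_assoc]
    have := int_aux hS (((List.finRange n).map fun i =>
          (dirD (EuclideanSpace.single i 1) : Module.End ℝ (smoothOff n)) ^ β i).prod (fundS n))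
          θ hθ hd0
    simp only [zero_smul, sub_zero] at this
    exact (this.const_mul _).const_mul _
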